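/- arXiv:2212.06074 — 2 statements merged into one kernel-verified Lean document; each statement's English description precedes it below -/
import Mathlib

section
/- Let P be a probability distribution on a finite set Y ⊆ ℝ, let O ⊆ ℝ be a finite output set, and let ℓ : ℝ × ℝ → ℝ≥0 be such that for every y ∈ ℝ, ℓ(ŷ, y) is strictly decreasing in ŷ on (−∞, y] and strictly increasing in ŷ on [y, ∞), and for every ŷ ∈ ℝ, ℓ(ŷ, y) is strictly decreasing in y on (−∞, ŷ] and strictly increasing in y on [ŷ, ∞). Then for every ε > 0 there exists a map Φ : Y → O such that L(RR-on-Bins^Φ_ε; P) = inf_M L(M; P), where the infimum is over all ε-DP mechanisms M with inputs in Y and outputs in O. -/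
/-- Transition probability of the `RR-on-Bins` mechanism with output set `Yh`,
map `Phi` and privacy parameter `eps`. -/
noncomputable def rrProb (eps : ℝ) (Yh : Finset ℝ) (Phi : ℝ → ℝ) (y yh : ℝ) : ℝ :=
  if yh = Phi y then Real.exp eps / (Real.exp eps + (Yh.card : ℝ) - 1)
  else 1 / (Real.exp eps + (Yh.card : ℝ) - 1)

/-- Expected loss of `RR-on-Bins` under a finitely supported prior `p` on `Y`. -/
noncomputable def rrLoss (l : ℝ → ℝ → ℝ) (eps : ℝ) (Yh : Finset ℝ) (Phi : ℝ → ℝ)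
    (Y : Finset ℝ) (p : ℝ → ℝ) : ℝ :=
  ∑ y ∈ Y, p y * ∑ yh ∈ Yh, rrProb eps Yh Phi y yh * l yh y

/-- A mechanism with inputs in `Y` and outputs in `O`, given by its transition
matrix `M`, is `eps`-DP feasible if rows are probability distributions on `O`
and the `eps`-DP constraint holds. -/
def IsFeasible (eps : ℝ) (Y O : Finset ℝ) (M : ℝ → ℝ → ℝ) : Prop :=
  (∀ y ∈ Y, ∀ yh ∈ O, 0 ≤ M y yh) ∧
  (∀ y ∈ Y, ∑ yh ∈ O, M y yh = 1) ∧
  (∀ y ∈ Y, ∀ y' ∈ Y, ∀ yh ∈ O, M y' yh ≤ Real.exp eps * M y yh)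

/-- Expected loss of a mechanism with matrix `M` under prior `p` on `Y`. -/
noncomputable def mechLoss (l : ℝ → ℝ → ℝ) (Y O : Finset ℝ) (p : ℝ → ℝ)
    (M : ℝ → ℝ → ℝ) : ℝ :=
  ∑ y ∈ Y, p y * ∑ yh ∈ O, M y yh * l yh y

theorem integral_floor_add (x : ℝ) : ∫ t in (0 : ℝ)..1, (⌊x + t⌋ : ℝ) = x := by
  have hfract : ∫ t in (0 : ℝ)..1, Int.fract (x + t) = 1 / 2 := by
    rw [intervalIntegral.integral_comp_add_left (fun t => Int.fract t) x]
    have hper : Function.Periodic (Int.fract : ℝ → ℝ) 1 := fun t => Int.fract_add_one t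
    have h := hper.intervalIntegral_add_eq x 0
    simp only [add_zero, zero_add] at h ⊢
    rw [h]
    have hid : ∫ t in (0 : ℝ)..1, Int.fract t = ∫ t in (0 : ℝ)..1, t := by
      apply intervalIntegral.integral_congr_ae
      have hne : ∀ᵐ t : ℝ, t ≠ 1 := by simp [MeasureTheory.ae_iff]
      filter_upwards [hne] with t ht hmem
      rw [Set.uIoc_of_le zero_le_one] at hmem
      exact Int.fract_eq_self.2 ⟨hmem.1.le, lt_of_le_of_ne hmem.2 ht⟩
    rw [hid]
    norm_num
  have hmono : Monotone fun t : ℝ => (⌊x + t⌋ : ℝ) := fun s t hst =>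
    Int.cast_le.2 (Int.floor_mono (by linarith))
  have hint : IntervalIntegrable (fun t : ℝ => (⌊x + t⌋ : ℝ)) MeasureTheory.volume 0 1 :=
    hmono.intervalIntegrable
  have hlin : IntervalIntegrable (fun t : ℝ => x + t) MeasureTheory.volume 0 1 :=
    (by fun_prop : Continuous fun t : ℝ => x + t).intervalIntegrable _ _
  have hsub := intervalIntegral.integral_sub hlin hint
  have hfr : ∫ t in (0 : ℝ)..1, (x + t - (⌊x + t⌋ : ℝ)) = 1 / 2 := hfract
  have hval : ∫ t in (0 : ℝ)..1, (x + t) = x + 1 / 2 := by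
    rw [intervalIntegral.integral_add (by simp) (by simp)]
    norm_num
  linarith

/-- Telescoping of a function of the partial sums of `m` along a finite set of reals. -/
theorem sum_telescope_partialSums (S : Finset ℝ) (m : ℝ → ℝ) (f : ℝ → ℤ) :
    ∑ x ∈ S, (f (∑ z ∈ S with z ≤ x, m z) - f (∑ z ∈ S with z < x, m z)) =
      f (∑ z ∈ S, m z) - f 0 := by
  induction S using Finset.induction_on_max with
  | empty => simp
  | insert a S ha ih =>
    have hnot : a ∉ S := fun h => lt_irrefl _ (ha a h)
    have hle : {z ∈ insert a S | z ≤ a} = insert a S := by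
      ext z; simp only [Finset.mem_filter, Finset.mem_insert]
      exact ⟨fun h => h.1, fun h => ⟨h, h.elim (fun e => e.le) fun h => (ha z h).le⟩⟩
    have hlt : {z ∈ insert a S | z < a} = S := by
      ext z; simp only [Finset.mem_filter, Finset.mem_insert]
      exact ⟨fun h => h.1.resolve_left h.2.ne, fun h => ⟨Or.inr h, ha z h⟩⟩
    have hrest : ∀ x ∈ S, {z ∈ insert a S | z ≤ x} = {z ∈ S | z ≤ x} ∧
        {z ∈ insert a S | z < x} = {z ∈ S | z < x} := by
      intro x hx
      have := ha x hx
      rw [Finset.filter_insert, Finset.filter_insert, if_neg (by linarith), if_neg (by linarith)]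
      exact ⟨rfl, rfl⟩
    have hold : ∑ x ∈ S, (f (∑ z ∈ insert a S with z ≤ x, m z) -
        f (∑ z ∈ insert a S with z < x, m z)) = f (∑ z ∈ S, m z) - f 0 := by
      rw [← ih]
      exact Finset.sum_congr rfl fun x hx => by rw [(hrest x hx).1, (hrest x hx).2]
    rw [Finset.sum_insert hnot, hle, hlt, hold]
    ring

/-- The number of points of the grid `ℤ - t` in the cell of `x`, when the points of `O` are laid
out on the line as consecutive cells of lengths `m`. -/
noncomputable def gridCount (O : Finset ℝ) (m : ℝ → ℝ) (t x : ℝ) : ℤ :=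
  ⌊(∑ z ∈ O with z ≤ x, m z) + t⌋ - ⌊(∑ z ∈ O with z < x, m z) + t⌋

theorem gridCount_nonneg {O : Finset ℝ} {m : ℝ → ℝ} (hm : ∀ x ∈ O, 0 ≤ m x) (t x : ℝ) :
    0 ≤ gridCount O m t x := by
  refine sub_nonneg.2 (Int.floor_mono (add_le_add_left ?_ t))
  refine Finset.sum_le_sum_of_subset_of_nonneg
    (Finset.monotone_filter_right _ fun z _ h => le_of_lt h) fun z hz _ => hm z ?_
  exact (Finset.mem_filter.1 hz).1

theorem sum_gridCount_of_lower {O L : Finset ℝ} (m : ℝ → ℝ) (t : ℝ) (hLO : L ⊆ O)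
    (hL : ∀ x ∈ L, ∀ z ∈ O, z ≤ x → z ∈ L) :
    ∑ x ∈ L, gridCount O m t x = ⌊(∑ z ∈ L, m z) + t⌋ - ⌊t⌋ := by
  have h := sum_telescope_partialSums L m fun u => ⌊u + t⌋
  simp only [zero_add] at h
  rw [← h]
  refine Finset.sum_congr rfl fun x hx => ?_
  have hle : {z ∈ O | z ≤ x} = {z ∈ L | z ≤ x} := by
    ext z; simp only [Finset.mem_filter]
    exact ⟨fun h => ⟨hL x hx z h.1 h.2, h.2⟩, fun h => ⟨hLO h.1, h.2⟩⟩
  have hlt : {z ∈ O | z < x} = {z ∈ L | z < x} := by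
    ext z; simp only [Finset.mem_filter]
    exact ⟨fun h => ⟨hL x hx z h.1 h.2.le, h.2⟩, fun h => ⟨hLO h.1, h.2⟩⟩
  rw [gridCount, hle, hlt]

theorem sum_gridCount_of_convex {O A : Finset ℝ} (m : ℝ → ℝ) (t : ℝ) (hAO : A ⊆ O)
    (hA : ∀ x ∈ A, ∀ x' ∈ A, ∀ z ∈ O, x ≤ z → z ≤ x' → z ∈ A) :
    ∃ u : ℝ, ∑ x ∈ A, gridCount O m t x = ⌊u + ∑ z ∈ A, m z⌋ - ⌊u⌋ := by
  classical
  rcases A.eq_empty_or_nonempty with rfl | ⟨a, ha⟩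
  · exact ⟨0, by simp⟩
  set L := {x ∈ O | ∀ b ∈ A, x < b} with hL
  set U := {x ∈ O | ∃ b ∈ A, x ≤ b} with hU
  have hLsum := sum_gridCount_of_lower (O := O) (L := L) m t (Finset.filter_subset _ _)
    (fun x hx z hz hzx => by
      simp only [hL, Finset.mem_filter] at hx ⊢
      exact ⟨hz, fun b hb => hzx.trans_lt (hx.2 b hb)⟩)
  have hUsum := sum_gridCount_of_lower (O := O) (L := U) m t (Finset.filter_subset _ _)
    (fun x hx z hz hzx => by
      simp only [hU, Finset.mem_filter] at hx ⊢
      obtain ⟨b, hb, hxb⟩ := hx.2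
      exact ⟨hz, b, hb, hzx.trans hxb⟩)
  have hdisj : Disjoint L A := Finset.disjoint_left.2 fun x hx hxA =>
    lt_irrefl x ((Finset.mem_filter.1 hx).2 x hxA)
  have hunion : L ∪ A = U := by
    ext x
    simp only [hL, hU, Finset.mem_union, Finset.mem_filter]
    constructor
    · rintro (h | h)
      · exact ⟨h.1, a, ha, (h.2 a ha).le⟩
      · exact ⟨hAO h, x, h, le_rfl⟩
    · rintro ⟨hxO, b, hb, hxb⟩
      by_cases h : ∀ b ∈ A, x < b
      · exact Or.inl ⟨hxO, h⟩
      · push Not at h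
        obtain ⟨b', hb', hx⟩ := h
        exact Or.inr (hA b' hb' b hb x hxO hx hxb)
  rw [← hunion, Finset.sum_union hdisj, Finset.sum_union hdisj] at hUsum
  refine ⟨(∑ z ∈ L, m z) + t, ?_⟩
  rw [show (∑ z ∈ L, m z) + t + ∑ z ∈ A, m z = (∑ z ∈ L, m z) + (∑ z ∈ A, m z) + t by ring]
  linarith

/-- Averaging over the offset of the grid recovers the cell lengths. -/
theorem nonneg_of_forall_gridCount (O : Finset ℝ) (m a : ℝ → ℝ) (b : ℝ)
    (h : ∀ t, 0 ≤ ∑ x ∈ O, (gridCount O m t x : ℝ) * a x + b) :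
    0 ≤ ∑ x ∈ O, m x * a x + b := by
  have hfl : ∀ u : ℝ, IntervalIntegrable (fun t : ℝ => (⌊u + t⌋ : ℝ)) MeasureTheory.volume 0 1 :=
    fun u => Monotone.intervalIntegrable fun s t hst =>
      Int.cast_le.2 (Int.floor_mono (by linarith))
  have hint : ∀ x, IntervalIntegrable (fun t => (gridCount O m t x : ℝ))
      MeasureTheory.volume 0 1 := by
    intro x
    simp only [gridCount, Int.cast_sub]
    exact (hfl _).sub (hfl _)
  have hval : ∀ x ∈ O, ∫ t in (0 : ℝ)..1, (gridCount O m t x : ℝ) = m x := by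
    intro x hx
    simp only [gridCount, Int.cast_sub]
    rw [intervalIntegral.integral_sub (hfl _) (hfl _), integral_floor_add, integral_floor_add]
    have hins : {z ∈ O | z ≤ x} = insert x {z ∈ O | z < x} := by
      ext z
      simp only [Finset.mem_filter, Finset.mem_insert, le_iff_lt_or_eq]
      constructor
      · rintro ⟨hz, h | h⟩
        · exact Or.inr ⟨hz, h⟩
        · exact Or.inl h
      · rintro (rfl | h)
        · exact ⟨hx, Or.inr rfl⟩
        · exact ⟨h.1, Or.inl h.2⟩
    rw [hins, Finset.sum_insert (by simp)]
    ring
  have hnn : 0 ≤ ∫ t in (0 : ℝ)..1, (∑ x ∈ O, (gridCount O m t x : ℝ) * a x + b) :=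
    intervalIntegral.integral_nonneg zero_le_one fun t _ => h t
  rw [intervalIntegral.integral_add
      (by simpa only [Finset.sum_fn] using
        IntervalIntegrable.sum O fun x _ => (hint x).mul_const (a x)) (by simp),
    intervalIntegral.integral_finsetSum fun x _ => (hint x).mul_const (a x)] at hnn
  simp only [intervalIntegral.integral_mul_const, intervalIntegral.integral_const, sub_zero,
    one_smul] at hnn
  rwa [Finset.sum_congr rfl fun x hx => by rw [hval x hx]] at hnn

theorem sum_rrProb_mul (l : ℝ → ℝ → ℝ) (eps : ℝ) {Z : Finset ℝ} {Phi : ℝ → ℝ} {y : ℝ}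
    (hy : Phi y ∈ Z) :
    ∑ z ∈ Z, rrProb eps Z Phi y z * l z y =
      (∑ z ∈ Z, l z y + (Real.exp eps - 1) * l (Phi y) y) / (Real.exp eps + Z.card - 1) := by
  have hterm : ∀ z, rrProb eps Z Phi y z * l z y =
      (l z y + if z = Phi y then (Real.exp eps - 1) * l z y else 0) /
        (Real.exp eps + Z.card - 1) := by
    intro z
    unfold rrProb
    split_ifs <;> ring
  rw [Finset.sum_congr rfl fun z _ => hterm z, ← Finset.sum_div, Finset.sum_add_distrib,
    Finset.sum_ite_eq' Z (Phi y), if_pos hy]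

theorem rrLoss_eq_div (l : ℝ → ℝ → ℝ) (eps : ℝ) (Y : Finset ℝ) (p Phi : ℝ → ℝ) :
    rrLoss l eps (Y.image Phi) Phi Y p =
      (∑ z ∈ Y.image Phi, ∑ y ∈ Y, p y * l z y +
        (Real.exp eps - 1) * ∑ y ∈ Y, p y * l (Phi y) y) /
          (Real.exp eps + (Y.image Phi).card - 1) := by
  rw [rrLoss, Finset.sum_congr rfl fun y hy => by
    rw [sum_rrProb_mul l eps (Finset.mem_image_of_mem Phi hy)]]
  rw [Finset.sum_comm, Finset.mul_sum, ← Finset.sum_add_distrib, Finset.sum_div]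
  refine Finset.sum_congr rfl fun y _ => ?_
  rw [← Finset.mul_sum]
  ring

/-- Randomized response on the multiset with multiplicities `N`, where each input prefers one of
the points of the multiset, costs at least as much as the best `RR-on-Bins` mechanism. -/
theorem mul_le_multiset_rr {l : ℝ → ℝ → ℝ} {eps : ℝ} {Y O : Finset ℝ} {p : ℝ → ℝ} {V : ℝ}
    (heps : 0 < eps) (hp1 : ∑ y ∈ Y, p y = 1)
    (hV : ∀ Phi : ℝ → ℝ, (∀ y ∈ Y, Phi y ∈ O) → V ≤ rrLoss l eps (Y.image Phi) Phi Y p)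
    {N : ℝ → ℤ} (hN : ∀ x ∈ O, 0 ≤ N x) {Phi : ℝ → ℝ} (hPhi : ∀ y ∈ Y, Phi y ∈ O)
    (hNPhi : ∀ y ∈ Y, 1 ≤ N (Phi y)) :
    V * (∑ x ∈ O, (N x : ℝ) + (Real.exp eps - 1)) ≤
      ∑ x ∈ O, (N x : ℝ) * ∑ y ∈ Y, p y * l x y +
        (Real.exp eps - 1) * ∑ y ∈ Y, p y * l (Phi y) y := by
  classical
  have hc : 1 < Real.exp eps := Real.one_lt_exp_iff.2 heps
  have hY : Y.Nonempty := by
    by_contra h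
    simp [Finset.not_nonempty_iff_eq_empty.1 h] at hp1
  have hconst : ∀ z ∈ O, V ≤ ∑ y ∈ Y, p y * l z y := by
    intro z hz
    have h := hV (fun _ => z) fun _ _ => hz
    rw [rrLoss_eq_div, Finset.image_const hY, Finset.sum_singleton, Finset.card_singleton] at h
    have he : Real.exp eps ≠ 0 := (Real.exp_pos eps).ne'
    calc V ≤ _ := h
      _ = _ := by push_cast; field_simp; ring
  have himage : Y.image Phi ⊆ O := Finset.image_subset_iff.2 hPhi
  have hcard : (0 : ℝ) ≤ (Y.image Phi).card := Nat.cast_nonneg _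
  have hRR := hV Phi hPhi
  rw [rrLoss_eq_div, le_div_iff₀ (by linarith)] at hRR
  have hind : ∀ g : ℝ → ℝ, ∑ x ∈ Y.image Phi, g x =
      ∑ x ∈ O, (if x ∈ Y.image Phi then 1 else 0) * g x := by
    intro g
    simp only [ite_mul, one_mul, zero_mul]
    rw [← Finset.sum_filter, Finset.filter_mem_eq_inter, Finset.inter_eq_right.2 himage]
  have hcard' : ((Y.image Phi).card : ℝ) = ∑ x ∈ O, (if x ∈ Y.image Phi then 1 else 0) := by
    have := hind fun _ => 1
    simpa using this
  have hrest : ∑ x ∈ O, ((N x : ℝ) - if x ∈ Y.image Phi then 1 else 0) * V ≤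
      ∑ x ∈ O, ((N x : ℝ) - if x ∈ Y.image Phi then 1 else 0) * ∑ y ∈ Y, p y * l x y := by
    refine Finset.sum_le_sum fun x hx => mul_le_mul_of_nonneg_left (hconst x hx) ?_
    split_ifs with h
    · obtain ⟨y, hy, rfl⟩ := Finset.mem_image.1 h
      exact sub_nonneg.2 (by exact_mod_cast hNPhi y hy)
    · simpa using hN x hx
  rw [hind fun z => ∑ y ∈ Y, p y * l z y, hcard'] at hRR
  rw [← Finset.sum_mul] at hrest
  simp only [sub_mul, Finset.sum_sub_distrib] at hrest
  linarith

/-- A weighted median level of `f`. -/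
theorem exists_level (O : Finset ℝ) (m f : ℝ → ℝ) (hm : 1 ≤ ∑ x ∈ O, m x) :
    ∃ r : ℝ, 1 ≤ ∑ x ∈ O with f x ≤ r, m x ∧ ∑ x ∈ O with f x < r, m x ≤ 1 := by
  classical
  set R := {r ∈ O.image f | 1 ≤ ∑ x ∈ O with f x ≤ r, m x} with hR
  have hO : O.Nonempty := by
    by_contra h
    norm_num [Finset.not_nonempty_iff_eq_empty.1 h] at hm
  have hRne : R.Nonempty := by
    obtain ⟨a, ha, hmax⟩ := O.exists_max_image f hO
    refine ⟨f a, Finset.mem_filter.2 ⟨Finset.mem_image_of_mem f ha, ?_⟩⟩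
    rwa [Finset.filter_true_of_mem hmax]
  obtain ⟨r, hr, hmin⟩ := R.exists_min_image id hRne
  refine ⟨r, (Finset.mem_filter.1 hr).2, ?_⟩
  by_contra! hlt
  have hne : {x ∈ O | f x < r}.Nonempty := by
    by_contra h
    norm_num [Finset.not_nonempty_iff_eq_empty.1 h] at hlt
  obtain ⟨a, ha, hmax⟩ := Finset.exists_max_image _ f hne
  have ha' := Finset.mem_filter.1 ha
  have heq : {x ∈ O | f x ≤ f a} = {x ∈ O | f x < r} := by
    ext x
    simp only [Finset.mem_filter]
    exact ⟨fun h => ⟨h.1, h.2.trans_lt ha'.2⟩,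
      fun h => ⟨h.1, hmax x (Finset.mem_filter.2 h)⟩⟩
  have := hmin (f a) (Finset.mem_filter.2 ⟨Finset.mem_image_of_mem f ha'.1, by
    rw [heq]
    exact hlt.le⟩)
  exact absurd ha'.2 (not_lt.2 this)

theorem exists_le_level_add {O : Finset ℝ} {N : ℝ → ℤ} {f : ℝ → ℝ} {r : ℝ}
    (hN : ∀ x ∈ O, 0 ≤ N x) (hge : 1 ≤ ∑ x ∈ O with f x ≤ r, N x)
    (hle : ∑ x ∈ O with f x < r, N x ≤ 1) :
    ∃ z ∈ O, 1 ≤ N z ∧ f z ≤ r + ∑ x ∈ O, (N x : ℝ) * min (f x - r) 0 := by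
  classical
  have hsum : ∑ x ∈ O, (N x : ℝ) * min (f x - r) 0 =
      ∑ x ∈ O with f x < r, (N x : ℝ) * (f x - r) := by
    rw [Finset.sum_filter]
    refine Finset.sum_congr rfl fun x _ => ?_
    split_ifs with h
    · rw [min_eq_left (by linarith)]
    · rw [min_eq_right (by linarith), mul_zero]
  rw [hsum]
  have hN' : ∀ x ∈ ({x ∈ O | f x < r} : Finset ℝ), 0 ≤ N x := fun x hx =>
    hN x (Finset.mem_filter.1 hx).1
  by_cases h : ∃ z ∈ ({x ∈ O | f x < r} : Finset ℝ), 1 ≤ N z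
  · obtain ⟨z, hz, hNz⟩ := h
    refine ⟨z, (Finset.mem_filter.1 hz).1, hNz, ?_⟩
    rw [← Finset.add_sum_erase _ _ hz] at hle
    have hnn : ∀ x ∈ ({x ∈ O | f x < r} : Finset ℝ).erase z, 0 ≤ N x := fun x hx =>
      hN' x (Finset.mem_of_mem_erase hx)
    have hrest := Finset.sum_nonneg hnn
    have hzero := (Finset.sum_eq_zero_iff_of_nonneg hnn).1 (by linarith)
    rw [← Finset.add_sum_erase _ _ hz,
      Finset.sum_eq_zero fun x hx => by rw [hzero x hx]; simp,
      show N z = 1 by linarith]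
    push_cast
    linarith
  · push Not at h
    rw [Finset.sum_eq_zero fun x hx => by
      rw [show N x = 0 by have := h x hx; have := hN' x hx; lia]; simp]
    obtain ⟨z, hz, hNz⟩ : ∃ z ∈ ({x ∈ O | f x ≤ r} : Finset ℝ), 0 < N z := by
      by_contra! hcon
      have := Finset.sum_nonpos hcon
      lia
    have hz' := Finset.mem_filter.1 hz
    exact ⟨z, hz'.1, hNz, by linarith [hz'.2]⟩

theorem le_max_of_unimodal {f : ℝ → ℝ} {y : ℝ} (hanti : StrictAntiOn f (Set.Iic y))
    (hmono : StrictMonoOn f (Set.Ici y)) {a z b : ℝ} (haz : a ≤ z) (hzb : z ≤ b) :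
    f z ≤ max (f a) (f b) := by
  rcases le_total z y with h | h
  · exact le_max_of_le_left (hanti.antitoneOn (haz.trans h) h haz)
  · exact le_max_of_le_right (hmono.monotoneOn h (h.trans hzb) hzb)

/-- The core inequality, for the column minima `m` rescaled so that every input has one unit of
additional mass to place. -/
theorem mul_le_of_levels {l : ℝ → ℝ → ℝ} {eps : ℝ} {Y O : Finset ℝ} {p : ℝ → ℝ} {V : ℝ}
    (heps : 0 < eps) (hp0 : ∀ y ∈ Y, 0 ≤ p y) (hp1 : ∑ y ∈ Y, p y = 1)
    (hquasi : ∀ y a z b : ℝ, a ≤ z → z ≤ b → l z y ≤ max (l a y) (l b y))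
    (hV : ∀ Phi : ℝ → ℝ, (∀ y ∈ Y, Phi y ∈ O) → V ≤ rrLoss l eps (Y.image Phi) Phi Y p)
    {m r : ℝ → ℝ} (hm : ∀ x ∈ O, 0 ≤ m x)
    (hge : ∀ y, 1 ≤ ∑ x ∈ O with l x y ≤ r y, m x)
    (hle : ∀ y, ∑ x ∈ O with l x y < r y, m x ≤ 1) :
    V * (∑ x ∈ O, m x + (Real.exp eps - 1)) ≤
      ∑ y ∈ Y, p y * (∑ x ∈ O, m x * l x y +
        (Real.exp eps - 1) * (r y + ∑ x ∈ O, m x * min (l x y - r y) 0)) := by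
  classical
  have hc : 1 < Real.exp eps := Real.one_lt_exp_iff.2 heps
  set a : ℝ → ℝ := fun x =>
    ∑ y ∈ Y, p y * (l x y + (Real.exp eps - 1) * min (l x y - r y) 0) - V with ha
  set b : ℝ := (Real.exp eps - 1) * (∑ y ∈ Y, p y * r y - V) with hb
  have hlinear : ∀ N : ℝ → ℝ, ∑ x ∈ O, N x * a x + b =
      ∑ y ∈ Y, p y * (∑ x ∈ O, N x * l x y +
        (Real.exp eps - 1) * (r y + ∑ x ∈ O, N x * min (l x y - r y) 0)) -
      V * (∑ x ∈ O, N x + (Real.exp eps - 1)) := by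
    intro N
    have hswap : ∑ x ∈ O, N x * ∑ y ∈ Y,
        p y * (l x y + (Real.exp eps - 1) * min (l x y - r y) 0) =
        ∑ y ∈ Y, p y * (∑ x ∈ O, N x * l x y +
          (Real.exp eps - 1) * ∑ x ∈ O, N x * min (l x y - r y) 0) := by
      simp only [Finset.mul_sum, mul_add, Finset.sum_add_distrib]
      congr 1
      · rw [Finset.sum_comm]
        exact Finset.sum_congr rfl fun _ _ => Finset.sum_congr rfl fun _ _ => by ring
      · rw [Finset.sum_comm]
        exact Finset.sum_congr rfl fun _ _ => Finset.sum_congr rfl fun _ _ => by ring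
    have hsplit : ∑ y ∈ Y, p y * (∑ x ∈ O, N x * l x y +
        (Real.exp eps - 1) * (r y + ∑ x ∈ O, N x * min (l x y - r y) 0)) =
        ∑ y ∈ Y, p y * (∑ x ∈ O, N x * l x y +
          (Real.exp eps - 1) * ∑ x ∈ O, N x * min (l x y - r y) 0) +
        (Real.exp eps - 1) * ∑ y ∈ Y, p y * r y := by
      rw [Finset.mul_sum, ← Finset.sum_add_distrib]
      exact Finset.sum_congr rfl fun _ _ => by ring
    simp only [ha, mul_sub, Finset.sum_sub_distrib]
    rw [hswap, hsplit, ← Finset.sum_mul, hb]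
    ring
  have key := nonneg_of_forall_gridCount O m a b fun t => ?_
  · rw [hlinear] at key
    linarith
  have hN : ∀ x ∈ O, 0 ≤ gridCount O m t x := fun x _ => gridCount_nonneg hm t x
  have hsel : ∀ y, ∃ z ∈ O, 1 ≤ gridCount O m t z ∧
      l z y ≤ r y + ∑ x ∈ O, (gridCount O m t x : ℝ) * min (l x y - r y) 0 := by
    intro y
    refine exists_le_level_add (f := fun x => l x y) hN ?_ ?_
    · obtain ⟨u, hu⟩ := sum_gridCount_of_convex m t
        (Finset.filter_subset (fun x => l x y ≤ r y) O) (by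
          intro x hx x' hx' z hz hxz hzx'
          simp only [Finset.mem_filter] at hx hx' ⊢
          exact ⟨hz, (hquasi y x z x' hxz hzx').trans (max_le hx.2 hx'.2)⟩)
      rw [hu]
      have : ⌊u + 1⌋ ≤ ⌊u + ∑ x ∈ O with l x y ≤ r y, m x⌋ :=
        Int.floor_mono (by linarith [hge y])
      rw [Int.floor_add_one] at this
      linarith
    · obtain ⟨u, hu⟩ := sum_gridCount_of_convex m t
        (Finset.filter_subset (fun x => l x y < r y) O) (by
          intro x hx x' hx' z hz hxz hzx'
          simp only [Finset.mem_filter] at hx hx' ⊢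
          exact ⟨hz, (hquasi y x z x' hxz hzx').trans_lt (max_lt hx.2 hx'.2)⟩)
      rw [hu]
      have : ⌊u + ∑ x ∈ O with l x y < r y, m x⌋ ≤ ⌊u + 1⌋ :=
        Int.floor_mono (by linarith [hle y])
      rw [Int.floor_add_one] at this
      linarith
  choose Phi hPhi hNPhi hlPhi using hsel
  have hmulti := mul_le_multiset_rr heps hp1 hV hN (fun y _ => hPhi y) fun y _ => hNPhi y
  rw [hlinear fun x => (gridCount O m t x : ℝ), sub_nonneg]
  refine hmulti.trans ?_
  simp only [mul_add _ _ ((Real.exp eps - 1) * _), Finset.sum_add_distrib]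
  refine add_le_add (le_of_eq ?_) ?_
  · simp only [Finset.mul_sum]
    rw [Finset.sum_comm]
    exact Finset.sum_congr rfl fun _ _ => Finset.sum_congr rfl fun _ _ => by ring
  · rw [Finset.mul_sum]
    refine Finset.sum_le_sum fun y hy => ?_
    have := mul_le_mul_of_nonneg_left (hlPhi y) (mul_nonneg (hp0 y hy) (sub_nonneg.2 hc.le))
    linarith

/-- Every feasible mechanism costs at least as much as the best `RR-on-Bins` mechanism. -/
theorem le_mechLoss {l : ℝ → ℝ → ℝ} {eps : ℝ} {Y O : Finset ℝ} {p : ℝ → ℝ} {V : ℝ}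
    (heps : 0 < eps) (hp0 : ∀ y ∈ Y, 0 ≤ p y) (hp1 : ∑ y ∈ Y, p y = 1)
    (hquasi : ∀ y a z b : ℝ, a ≤ z → z ≤ b → l z y ≤ max (l a y) (l b y))
    (hV : ∀ Phi : ℝ → ℝ, (∀ y ∈ Y, Phi y ∈ O) → V ≤ rrLoss l eps (Y.image Phi) Phi Y p)
    {M : ℝ → ℝ → ℝ} (hM : IsFeasible eps Y O M) : V ≤ mechLoss l Y O p M := by
  classical
  obtain ⟨hM0, hM1, hMdp⟩ := hM
  have hc : 1 < Real.exp eps := Real.one_lt_exp_iff.2 heps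
  have hY : Y.Nonempty := by
    by_contra h
    simp [Finset.not_nonempty_iff_eq_empty.1 h] at hp1
  choose arg harg hargmin using fun x => Y.exists_min_image (fun y => M y x) hY
  set m : ℝ → ℝ := fun x => M (arg x) x with hmdef
  have hm0 : ∀ x ∈ O, 0 ≤ m x := fun x hx => hM0 _ (harg x) x hx
  have hmle : ∀ y ∈ Y, ∀ x ∈ O, m x ≤ M y x := fun y hy x _ => hargmin x y hy
  have hlem : ∀ y ∈ Y, ∀ x ∈ O, M y x ≤ Real.exp eps * m x := fun y hy x hx =>
    hMdp _ (harg x) y hy x hx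
  obtain ⟨y₀, hy₀⟩ := hY
  have hs1 : ∑ x ∈ O, m x ≤ 1 := hM1 y₀ hy₀ ▸ Finset.sum_le_sum (hmle y₀ hy₀)
  have hs2 : 1 ≤ Real.exp eps * ∑ x ∈ O, m x := by
    rw [← hM1 y₀ hy₀, Finset.mul_sum]
    exact Finset.sum_le_sum (hlem y₀ hy₀)
  obtain ⟨w, hw⟩ : ∃ w, w = (1 - ∑ x ∈ O, m x) / (Real.exp eps - 1) := ⟨_, rfl⟩
  have hwc : w * (Real.exp eps - 1) = 1 - ∑ x ∈ O, m x := by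
    rw [hw, div_mul_cancel₀]; linarith
  have hw0 : 0 ≤ w := hw ▸ div_nonneg (sub_nonneg.2 hs1) (sub_nonneg.2 hc.le)
  rcases hw0.eq_or_lt with h0 | hwpos
  · -- all the rows of `M` agree, so `M` is a mixture of constant mechanisms
    have hsum : ∑ x ∈ O, m x = 1 := by rw [← h0] at hwc; linarith
    have hconst : ∀ x ∈ O, V ≤ ∑ y ∈ Y, p y * l x y := by
      intro x hx
      have h := mul_le_multiset_rr heps hp1 hV (N := fun z => if z = x then 1 else 0)
        (fun z _ => by split_ifs <;> norm_num) (Phi := fun _ => x) (fun _ _ => hx)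
        (fun _ _ => by simp)
      simp [hx] at h
      nlinarith [Real.exp_pos eps]
    have heq : ∀ y ∈ Y, ∀ x ∈ O, m x = M y x := fun y hy =>
      (Finset.sum_eq_sum_iff_of_le (hmle y hy)).1 (by rw [hsum, hM1 y hy])
    calc V = ∑ x ∈ O, m x * V := by rw [← Finset.sum_mul, hsum, one_mul]
      _ ≤ ∑ x ∈ O, m x * ∑ y ∈ Y, p y * l x y :=
        Finset.sum_le_sum fun x hx => mul_le_mul_of_nonneg_left (hconst x hx) (hm0 x hx)
      _ = mechLoss l Y O p M := by
        simp only [mechLoss, Finset.mul_sum]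
        rw [Finset.sum_comm]
        refine Finset.sum_congr rfl fun y hy => Finset.sum_congr rfl fun x hx => ?_
        rw [heq y hy x hx]
        ring
  have hws : w ≤ ∑ x ∈ O, m x := by
    rw [hw, div_le_iff₀ (by linarith)]
    linarith
  have hscale : 1 ≤ ∑ x ∈ O, m x / w := by
    rwa [← Finset.sum_div, one_le_div hwpos]
  choose r hge hle using fun y => exists_level O (fun x => m x / w) (fun x => l x y) hscale
  have key := mul_le_of_levels heps hp0 hp1 hquasi hV (fun x hx => div_nonneg (hm0 x hx) hwpos.le)
    hge hle
  have hV1 : V = w * (V * (∑ x ∈ O, m x / w + (Real.exp eps - 1))) := by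
    rw [← Finset.sum_div]
    field_simp
    linear_combination -V * hwc
  rw [hV1]
  refine (mul_le_mul_of_nonneg_left key hwpos.le).trans ?_
  rw [mechLoss, Finset.mul_sum]
  refine Finset.sum_le_sum fun y hy => ?_
  have hcancel : ∀ g : ℝ → ℝ, w * ∑ x ∈ O, m x / w * g x = ∑ x ∈ O, m x * g x := by
    intro g
    rw [Finset.mul_sum]
    exact Finset.sum_congr rfl fun x _ => by field_simp
  have hrow : ∑ x ∈ O, m x * l x y + (Real.exp eps - 1) *
      (w * r y + ∑ x ∈ O, m x * min (l x y - r y) 0) ≤ ∑ x ∈ O, M y x * l x y := by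
    have hterm : ∀ x ∈ O, m x * l x y + (Real.exp eps - 1) * (m x * min (l x y - r y) 0) +
        (M y x - m x) * r y ≤ M y x * l x y := by
      intro x hx
      have h1 := hmle y hy x hx
      have h2 := hlem y hy x hx
      rcases le_total (l x y - r y) 0 with h | h
      · rw [min_eq_left h]
        nlinarith [mul_nonneg (sub_nonneg.2 h2) (neg_nonneg.2 h)]
      · rw [min_eq_right h]
        nlinarith [mul_nonneg (sub_nonneg.2 h1) h]
    have hsum := Finset.sum_le_sum hterm
    rw [Finset.sum_add_distrib, Finset.sum_add_distrib, ← Finset.mul_sum, ← Finset.sum_mul,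
      Finset.sum_sub_distrib, hM1 y hy] at hsum
    linear_combination hsum + r y * hwc
  calc _ = p y * (w * ∑ x ∈ O, m x / w * l x y + (Real.exp eps - 1) *
        (w * r y + w * ∑ x ∈ O, m x / w * min (l x y - r y) 0)) := by ring
    _ ≤ _ := by
      rw [hcancel, hcancel]
      exact mul_le_mul_of_nonneg_left hrow (hp0 y hy)

theorem rrLoss_mem_feasible (l : ℝ → ℝ → ℝ) {eps : ℝ} (heps : 0 < eps) {Y O : Finset ℝ}
    (p : ℝ → ℝ) {Phi : ℝ → ℝ} (hPhi : ∀ y ∈ Y, Phi y ∈ O) :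
    ∃ M : ℝ → ℝ → ℝ, IsFeasible eps Y O M ∧
      rrLoss l eps (Y.image Phi) Phi Y p = mechLoss l Y O p M := by
  classical
  have hc : 1 < Real.exp eps := Real.one_lt_exp_iff.2 heps
  set Z := Y.image Phi with hZ
  have himage : Z ⊆ O := Finset.image_subset_iff.2 hPhi
  have hD : 0 < Real.exp eps + (Z.card : ℝ) - 1 := by
    have : (0 : ℝ) ≤ Z.card := Nat.cast_nonneg _
    linarith
  have hrestrict : ∀ g : ℝ → ℝ, ∑ x ∈ O, (if x ∈ Z then g x else 0) = ∑ x ∈ Z, g x := by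
    intro g
    rw [← Finset.sum_filter, Finset.filter_mem_eq_inter, Finset.inter_eq_right.2 himage]
  have hpos : ∀ y x, 0 ≤ rrProb eps Z Phi y x := by
    intro y x
    unfold rrProb
    split_ifs <;> positivity
  refine ⟨fun y x => if x ∈ Z then rrProb eps Z Phi y x else 0, ⟨?_, ?_, ?_⟩, ?_⟩
  · intro y _ x _
    dsimp only
    split_ifs
    exacts [hpos y x, le_rfl]
  · intro y hy
    rw [hrestrict]
    have h := sum_rrProb_mul (fun _ _ => 1) eps (Finset.mem_image_of_mem Phi hy)
    simp only [mul_one, Finset.sum_const, nsmul_eq_mul] at h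
    rw [← hZ] at h
    rw [h, div_eq_one_iff_eq hD.ne']
    ring
  · intro y _ y' _ x _
    dsimp only
    split_ifs
    · unfold rrProb
      rw [← sub_nonneg]
      split_ifs
      all_goals
        field_simp
        nlinarith
    · simp
  · simp only [rrLoss, mechLoss, ite_mul, zero_mul]
    exact Finset.sum_congr rfl fun y _ => by rw [hrestrict]

theorem exists_forall_rrLoss_le (l : ℝ → ℝ → ℝ) (eps : ℝ) (Y : Finset ℝ) {O : Finset ℝ}
    (hO : O.Nonempty) (p : ℝ → ℝ) :
    ∃ Phi : ℝ → ℝ, (∀ y ∈ Y, Phi y ∈ O) ∧ ∀ Psi : ℝ → ℝ, (∀ y ∈ Y, Psi y ∈ O) →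
      rrLoss l eps (Y.image Phi) Phi Y p ≤ rrLoss l eps (Y.image Psi) Psi Y p := by
  classical
  obtain ⟨o, ho⟩ := hO
  have : Nonempty (Y → O) := ⟨fun _ => ⟨o, ho⟩⟩
  let extend : (Y → O) → ℝ → ℝ := fun g y => if h : y ∈ Y then g ⟨y, h⟩ else o
  obtain ⟨g, hg⟩ := Finite.exists_min fun g : Y → O =>
    rrLoss l eps (Y.image (extend g)) (extend g) Y p
  refine ⟨extend g, fun y hy => by simp [extend, hy], fun Psi hPsi => ?_⟩
  have hext : ∀ y ∈ Y, extend (fun y => ⟨Psi y, hPsi y y.2⟩) y = Psi y := fun y hy => by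
    simp [extend, hy]
  refine (hg fun y => ⟨Psi y, hPsi y y.2⟩).trans (le_of_eq ?_)
  rw [Finset.image_congr hext]
  refine Finset.sum_congr rfl fun y hy => ?_
  simp only [rrProb, hext y hy]

/-- For strictly unimodal losses, some `RR-on-Bins` mechanism (with output set the
range `Phi(Y) ⊆ O`) achieves the infimum of the expected loss over all `eps`-DP
mechanisms with inputs in `Y` and outputs in `O`. -/
theorem stmt1
    (l : ℝ → ℝ → ℝ) (hl0 : ∀ yh y, 0 ≤ l yh y)
    (h1 : ∀ y : ℝ, StrictAntiOn (fun yh => l yh y) (Set.Iic y))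
    (h2 : ∀ y : ℝ, StrictMonoOn (fun yh => l yh y) (Set.Ici y))
    (h3 : ∀ yh : ℝ, StrictAntiOn (fun y => l yh y) (Set.Iic yh))
    (h4 : ∀ yh : ℝ, StrictMonoOn (fun y => l yh y) (Set.Ici yh))
    (Y O : Finset ℝ) (hO : O.Nonempty)
    (p : ℝ → ℝ) (hp0 : ∀ y ∈ Y, 0 ≤ p y) (hp1 : ∑ y ∈ Y, p y = 1)
    (eps : ℝ) (heps : 0 < eps) :
    ∃ Phi : ℝ → ℝ, (∀ y ∈ Y, Phi y ∈ O) ∧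
      rrLoss l eps (Y.image Phi) Phi Y p =
        sInf { L : ℝ | ∃ M : ℝ → ℝ → ℝ, IsFeasible eps Y O M ∧ L = mechLoss l Y O p M } := by
  obtain ⟨Phi, hPhi, hmin⟩ := exists_forall_rrLoss_le l eps Y hO p
  have hleast : IsLeast
      {L : ℝ | ∃ M : ℝ → ℝ → ℝ, IsFeasible eps Y O M ∧ L = mechLoss l Y O p M}
      (rrLoss l eps (Y.image Phi) Phi Y p) := by
    refine ⟨rrLoss_mem_feasible l heps p hPhi, ?_⟩
    rintro L ⟨M, hM, rfl⟩
    exact le_mechLoss heps hp0 hp1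
      (fun y _ _ _ haz hzb => le_max_of_unimodal (h1 y) (h2 y) haz hzb) hmin hM
  exact ⟨Phi, hPhi, hleast.csInf_eq.symm⟩
end

section
/- Let Y = {y¹ < y² < ⋯ < y^k} ⊆ ℝ be finite with probability weights (p_y)_{y∈Y}, let ε > 0, and let ℓ : ℝ × ℝ → ℝ≥0 satisfy Assumption 1. For 1 ≤ r ≤ i ≤ k define L(r, i) := inf_{ŷ∈ℝ} Σ_{y∈Y} p_y · e^{ε·1[y^r ≤ y ≤ y^i]} · ℓ(ŷ, y), and for 0 ≤ j ≤ i ≤ k define C(i, j) := inf over all maps Φ : {y¹, …, yⁱ} → ℝ whose fibers are intervals (sets of consecutive elements of {y¹, …, yⁱ}) and whose induced partition of {y¹, …, yⁱ} has exactly j parts S₁, …, S_j, of Σ_{m=1}^{j} Σ_{y∈Y} p_y · e^{ε·1[y ∈ S_m]} · ℓ(Φ(S_m), y) (with C(0,0) = 0). Then for all 1 ≤ j ≤ i ≤ k, C(i, j) = min_{j−1 ≤ r < i} [ C(r, j − 1) + L(r + 1, i) ]. -/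
open scoped ENNReal

/-- `dpL yv p l eps r i` (for `1 ≤ r ≤ i ≤ k`, 1-indexed): the quantity
`L[r][i] = inf_{yh ∈ ℝ} Σ_{t} p_t · e^{eps·1[y^r ≤ y^t ≤ y^i]} · l(yh, y^t)`
from the dynamic program, valued in `ℝ≥0∞`. -/
noncomputable def dpL {k : ℕ} (yv : Fin k → ℝ) (p : Fin k → ℝ) (l : ℝ → ℝ → ℝ)
    (eps : ℝ) (r i : ℕ) : ℝ≥0∞ :=
  ⨅ yh : ℝ, ∑ t : Fin k,
    ENNReal.ofReal (p t) *
      (if r ≤ t.val + 1 ∧ t.val + 1 ≤ i then ENNReal.ofReal (Real.exp eps) else 1) *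
      ENNReal.ofReal (l yh (yv t))

/-- `dpC yv p l eps i j`: the optimal cost `A[i][j]` over all maps `Phi` defined on
the first `i` labels whose fibers are intervals and which take exactly `j` distinct
values (i.e. whose induced partition has exactly `j` parts), of
`Σ_{parts S} Σ_y p_y · e^{eps·1[y ∈ S]} · l(Phi(S), y)`, valued in `ℝ≥0∞`
(it is `∞` when no such map exists). -/
noncomputable def dpC {k : ℕ} (yv : Fin k → ℝ) (p : Fin k → ℝ) (l : ℝ → ℝ → ℝ)
    (eps : ℝ) (i j : ℕ) : ℝ≥0∞ :=
  sInf { c : ℝ≥0∞ | ∃ Phi : Fin k → ℝ,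
    (∀ t₁ t₂ t₃ : Fin k, t₁.val < i → t₃.val < i → t₁ ≤ t₂ → t₂ ≤ t₃ →
      Phi t₁ = Phi t₃ → Phi t₂ = Phi t₁) ∧
    ((Finset.univ.filter (fun t : Fin k => t.val < i)).image Phi).card = j ∧
    c = ∑ v ∈ (Finset.univ.filter (fun t : Fin k => t.val < i)).image Phi,
          ∑ t : Fin k,
            ENNReal.ofReal (p t) *
              (if t.val < i ∧ Phi t = v then ENNReal.ofReal (Real.exp eps) else 1) *
              ENNReal.ofReal (l v (yv t)) }

/-- Cost of the prediction `v` when the labels satisfying `P` have their weight multiplied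
by `exp eps`. -/
noncomputable def binCost {k : ℕ} (yv p : Fin k → ℝ) (l : ℝ → ℝ → ℝ) (eps : ℝ)
    (P : Fin k → Prop) [DecidablePred P] (v : ℝ) : ℝ≥0∞ :=
  ∑ t : Fin k, ENNReal.ofReal (p t) *
    (if P t then ENNReal.ofReal (Real.exp eps) else 1) * ENNReal.ofReal (l v (yv t))

/-- The set of values taken by `Phi` on the first `i` labels. -/
noncomputable def prefixImage {k : ℕ} (i : ℕ) (Phi : Fin k → ℝ) : Finset ℝ :=
  (Finset.univ.filter (fun t : Fin k => t.val < i)).image Phi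

/-- Cost of the map `Phi` on the first `i` labels, summed over its parts. -/
noncomputable def prefixCost {k : ℕ} (yv p : Fin k → ℝ) (l : ℝ → ℝ → ℝ) (eps : ℝ)
    (i : ℕ) (Phi : Fin k → ℝ) : ℝ≥0∞ :=
  ∑ v ∈ prefixImage i Phi, binCost yv p l eps (fun t => t.val < i ∧ Phi t = v) v

/-- The fibers of `Phi` on the first `i` labels are intervals. -/
def IntervalFibers {k : ℕ} (i : ℕ) (Phi : Fin k → ℝ) : Prop :=
  ∀ t₁ t₂ t₃ : Fin k, t₁.val < i → t₃.val < i → t₁ ≤ t₂ → t₂ ≤ t₃ →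
    Phi t₁ = Phi t₃ → Phi t₂ = Phi t₁

section

variable {k : ℕ} {yv p : Fin k → ℝ} {l : ℝ → ℝ → ℝ} {eps : ℝ}

lemma binCost_congr {P Q : Fin k → Prop} [DecidablePred P] [DecidablePred Q]
    (h : ∀ t, P t ↔ Q t) (v : ℝ) : binCost yv p l eps P v = binCost yv p l eps Q v := by
  simp only [binCost, h]

lemma continuous_binCost (hcont : ∀ y : ℝ, Continuous fun yh => l yh y)
    (P : Fin k → Prop) [DecidablePred P] : Continuous (binCost yv p l eps P) := by
  refine continuous_finsetSum _ fun t _ => ?_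
  refine (ENNReal.continuous_const_mul (ENNReal.mul_ne_top ENNReal.ofReal_ne_top ?_)).comp
    (ENNReal.continuous_ofReal.comp (hcont _))
  split_ifs
  · exact ENNReal.ofReal_ne_top
  · exact ENNReal.one_ne_top

lemma le_dpL_of_notMem (hcont : ∀ y : ℝ, Continuous fun yh => l yh y) (r i : ℕ)
    (S : Finset ℝ) (c : ℝ≥0∞)
    (h : ∀ w ∉ S,
      c ≤ binCost yv p l eps (fun t => r ≤ t.val + 1 ∧ t.val + 1 ≤ i) w) :
    c ≤ dpL yv p l eps r i := by
  refine le_iInf fun yh => ?_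
  have hclosed : IsClosed
      {w | c ≤ binCost yv p l eps (fun t => r ≤ t.val + 1 ∧ t.val + 1 ≤ i) w} :=
    isClosed_le continuous_const (continuous_binCost hcont _)
  have hdense : Dense ((S : Set ℝ)ᶜ) := S.countable_toSet.dense_compl ℝ
  exact hclosed.closure_subset_iff.2 (fun w hw => h w hw) (hdense yh)

lemma mem_prefixImage {i : ℕ} {Phi : Fin k → ℝ} {v : ℝ} :
    v ∈ prefixImage i Phi ↔ ∃ t : Fin k, t.val < i ∧ Phi t = v := by
  simp [prefixImage]

lemma card_prefixImage_le (i : ℕ) (Phi : Fin k → ℝ) : (prefixImage i Phi).card ≤ i := by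
  refine Finset.card_image_le.trans ?_
  rw [← Finset.card_map Fin.valEmbedding]
  refine (Finset.card_le_card (t := Finset.range i) fun x hx => ?_).trans_eq (by simp)
  simp only [Finset.mem_map, Finset.mem_filter, Finset.mem_univ, true_and] at hx
  obtain ⟨t, ht, rfl⟩ := hx
  simpa using ht

lemma prefixImage_congr {i : ℕ} {Phi Psi : Fin k → ℝ}
    (h : ∀ t : Fin k, t.val < i → Phi t = Psi t) : prefixImage i Phi = prefixImage i Psi :=
  Finset.image_congr fun t ht => h t (by simpa using ht)

lemma prefixCost_congr {i : ℕ} {Phi Psi : Fin k → ℝ}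
    (h : ∀ t : Fin k, t.val < i → Phi t = Psi t) :
    prefixCost yv p l eps i Phi = prefixCost yv p l eps i Psi := by
  rw [prefixCost, prefixCost, prefixImage_congr h]
  refine Finset.sum_congr rfl fun v _ => binCost_congr (fun t => ?_) v
  exact and_congr_right fun ht => by rw [h t ht]

lemma dpC_le {i j : ℕ} {Phi : Fin k → ℝ} (hfib : IntervalFibers i Phi)
    (hcard : (prefixImage i Phi).card = j) :
    dpC yv p l eps i j ≤ prefixCost yv p l eps i Phi :=
  sInf_le ⟨Phi, hfib, hcard, rfl⟩

lemma le_dpC {i j : ℕ} {c : ℝ≥0∞}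
    (h : ∀ Phi : Fin k → ℝ, IntervalFibers i Phi → (prefixImage i Phi).card = j →
      c ≤ prefixCost yv p l eps i Phi) : c ≤ dpC yv p l eps i j := by
  refine le_sInf ?_
  rintro _ ⟨Phi, hfib, hcard, rfl⟩
  exact h Phi hfib hcard

section LastPart

variable {r i : ℕ} {Phi : Fin k → ℝ} {w : ℝ}

lemma notMem_prefixImage_of_last (hlo : ∀ t : Fin k, t.val < r → Phi t ≠ w) :
    w ∉ prefixImage r Phi := by
  rw [mem_prefixImage]
  rintro ⟨t, ht, h⟩
  exact hlo t ht h

lemma prefixImage_eq_insert (hri : r < i) (hik : i ≤ k)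
    (hhi : ∀ t : Fin k, r ≤ t.val → t.val < i → Phi t = w) :
    prefixImage i Phi = insert w (prefixImage r Phi) := by
  ext v
  rw [Finset.mem_insert, mem_prefixImage, mem_prefixImage]
  constructor
  · rintro ⟨t, ht, rfl⟩
    by_cases h : t.val < r
    · exact Or.inr ⟨t, h, rfl⟩
    · exact Or.inl (hhi t (not_lt.1 h) ht)
  · rintro (rfl | ⟨t, ht, rfl⟩)
    · exact ⟨⟨r, hri.trans_le hik⟩, hri, hhi _ le_rfl hri⟩
    · exact ⟨t, ht.trans hri, rfl⟩

lemma card_prefixImage_of_last (hri : r < i) (hik : i ≤ k)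
    (hlo : ∀ t : Fin k, t.val < r → Phi t ≠ w)
    (hhi : ∀ t : Fin k, r ≤ t.val → t.val < i → Phi t = w) :
    (prefixImage i Phi).card = (prefixImage r Phi).card + 1 := by
  rw [prefixImage_eq_insert hri hik hhi,
    Finset.card_insert_of_notMem (notMem_prefixImage_of_last hlo)]

lemma prefixCost_of_last (hri : r < i) (hik : i ≤ k)
    (hlo : ∀ t : Fin k, t.val < r → Phi t ≠ w)
    (hhi : ∀ t : Fin k, r ≤ t.val → t.val < i → Phi t = w) :
    prefixCost yv p l eps i Phi = prefixCost yv p l eps r Phi +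
      binCost yv p l eps (fun t => r + 1 ≤ t.val + 1 ∧ t.val + 1 ≤ i) w := by
  have hw := notMem_prefixImage_of_last hlo
  rw [prefixCost, prefixImage_eq_insert hri hik hhi, Finset.sum_insert hw, add_comm, prefixCost]
  congr 1
  · refine Finset.sum_congr rfl fun v hv => binCost_congr (fun t => ?_) v
    refine ⟨fun ⟨ht, h⟩ => ⟨?_, h⟩, fun ⟨ht, h⟩ => ⟨ht.trans hri, h⟩⟩
    by_contra hr
    rw [hhi t (not_lt.1 hr) ht] at h
    exact hw (h ▸ hv)
  · refine binCost_congr (fun t => ?_) w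
    refine ⟨fun ⟨ht, h⟩ => ⟨?_, ht⟩, fun ⟨hr, ht⟩ => ⟨ht, hhi t (by omega) ht⟩⟩
    by_contra hr
    exact hlo t (by omega) h

end LastPart

lemma dpC_succ_le (hcont : ∀ y : ℝ, Continuous fun yh => l yh y) {r i m : ℕ}
    (hri : r < i) (hik : i ≤ k) :
    dpC yv p l eps i (m + 1) ≤ dpC yv p l eps r m + dpL yv p l eps (r + 1) i := by
  rw [← tsub_le_iff_right]
  refine le_dpC fun Phi hfib hcard => ?_
  rw [tsub_le_iff_right, ← tsub_le_iff_left]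
  refine le_dpL_of_notMem hcont _ _ (prefixImage r Phi) _ fun w hw => ?_
  rw [tsub_le_iff_left]
  let Psi : Fin k → ℝ := fun t => if t.val < r then Phi t else w
  have hPsi : ∀ t : Fin k, t.val < r → Psi t = Phi t := fun t ht => if_pos ht
  have hhi : ∀ t : Fin k, r ≤ t.val → t.val < i → Psi t = w :=
    fun t ht _ => if_neg (not_lt.2 ht)
  have hlo : ∀ t : Fin k, t.val < r → Psi t ≠ w := fun t ht h =>
    hw (mem_prefixImage.2 ⟨t, ht, (hPsi t ht).symm.trans h⟩)
  rw [← prefixCost_congr hPsi, ← prefixCost_of_last hri hik hlo hhi]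
  refine dpC_le ?_ ?_
  · intro t₁ t₂ t₃ h₁ h₃ h₁₂ h₂₃ h
    have h₁₂' : t₁.val ≤ t₂.val := h₁₂
    have h₂₃' : t₂.val ≤ t₃.val := h₂₃
    by_cases hr₁ : t₁.val < r
    · by_cases hr₃ : t₃.val < r
      · rw [hPsi _ hr₁, hPsi _ hr₃] at h
        rw [hPsi _ hr₁, hPsi _ (by omega)]
        exact hfib t₁ t₂ t₃ hr₁ hr₃ h₁₂ h₂₃ h
      · exact absurd (h.trans (hhi _ (not_lt.1 hr₃) h₃)) (hlo _ hr₁)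
    · rw [hhi t₂ (by omega) (by omega), hhi t₁ (by omega) h₁]
  · rw [card_prefixImage_of_last hri hik hlo hhi, prefixImage_congr hPsi, hcard]

/-- An interval-fibered map splits off its last part. -/
lemma exists_last_part {i : ℕ} {Phi : Fin k → ℝ} (hi : 0 < i) (hik : i ≤ k)
    (hfib : IntervalFibers i Phi) :
    ∃ r w, r < i ∧ (∀ t : Fin k, t.val < r → Phi t ≠ w) ∧
      ∀ t : Fin k, r ≤ t.val → t.val < i → Phi t = w := by
  classical
  let z : Fin k := ⟨i - 1, by omega⟩
  have hex : ∃ n, ∃ t : Fin k, t.val = n ∧ Phi t = Phi z := ⟨_, z, rfl, rfl⟩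
  obtain ⟨s, hs, hsz⟩ := Nat.find_spec hex
  have hle : Nat.find hex ≤ i - 1 := Nat.find_min' hex ⟨z, rfl, rfl⟩
  refine ⟨Nat.find hex, Phi z, by omega, fun t ht h => Nat.find_min hex ht ⟨t, rfl, h⟩,
    fun t ht hti => ?_⟩
  refine (hfib s t z (by omega) (Nat.sub_lt hi one_pos) ?_ ?_ hsz).trans hsz
  · exact Fin.le_def.2 (by omega)
  · exact Fin.le_def.2 (Nat.le_sub_one_of_lt hti)

end

/-- Correctness of the dynamic-programming recurrence for computing the optimal
`RR-on-Bins` mechanism: for `1 ≤ j ≤ i ≤ k`,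
`C(i, j) = min_{j-1 ≤ r < i} [ C(r, j-1) + L(r+1, i) ]`. -/
theorem stmt17
    (k : ℕ) (yv : Fin k → ℝ) (hyv : StrictMono yv)
    (p : Fin k → ℝ) (hp0 : ∀ t, 0 ≤ p t) (hp1 : ∑ t, p t = 1)
    (eps : ℝ) (heps : 0 < eps)
    (l : ℝ → ℝ → ℝ) (hl0 : ∀ yh y, 0 ≤ l yh y)
    (hcont : ∀ y : ℝ, Continuous fun yh => l yh y)
    (ha1 : ∀ y : ℝ, AntitoneOn (fun yh => l yh y) (Set.Iic y))
    (hm1 : ∀ y : ℝ, MonotoneOn (fun yh => l yh y) (Set.Ici y))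
    (ha2 : ∀ yh : ℝ, AntitoneOn (fun y => l yh y) (Set.Iic yh))
    (hm2 : ∀ yh : ℝ, MonotoneOn (fun y => l yh y) (Set.Ici yh)) :
    ∀ i j : ℕ, ∀ _hj : 1 ≤ j, ∀ _hji : j ≤ i, ∀ _hik : i ≤ k,
      dpC yv p l eps i j =
        (Finset.Icc (j - 1) (i - 1)).inf'
          (Finset.nonempty_Icc.mpr (by omega))
          (fun r => dpC yv p l eps r (j - 1) + dpL yv p l eps (r + 1) i) := by
  intro i j hj hji hik
  obtain ⟨m, rfl⟩ : ∃ m, j = m + 1 := ⟨j - 1, by omega⟩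
  refine le_antisymm (Finset.le_inf' _ _ fun r hr => ?_) (le_dpC fun Phi hfib hcard => ?_)
  · have := Finset.mem_Icc.1 hr
    exact dpC_succ_le hcont (by omega) hik
  · obtain ⟨r, w, hri, hlo, hhi⟩ := exists_last_part (by omega) hik hfib
    have hcard_r : (prefixImage r Phi).card = m := by
      have := card_prefixImage_of_last hri hik hlo hhi
      omega
    have hmr : m ≤ r := hcard_r ▸ card_prefixImage_le r Phi
    refine (Finset.inf'_le _ (Finset.mem_Icc.2 (⟨by omega, by omega⟩ :
      m + 1 - 1 ≤ r ∧ r ≤ i - 1))).trans ?_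
    rw [prefixCost_of_last hri hik hlo hhi]
    refine add_le_add (dpC_le (fun t₁ t₂ t₃ h₁ h₃ => ?_) hcard_r) (iInf_le _ w)
    exact hfib t₁ t₂ t₃ (h₁.trans hri) (h₃.trans hri)
end
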